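/- Let θ ∈ ℝ with θ ≠ 0, and let A : ℝ → ℝ be a smooth function such that A, A', A'', A''' are square-integrable and (L A)' + θ A = 0 on ℝ. Then A ≡ 0. Consequently, for every θ > 0 and every F ∈ L²(ℝ), there is at most one A with A, A', A'', A''' ∈ L²(ℝ) solving (L A)' + θ A = F. -/

import Mathlib

open Real MeasureTheory Filter

noncomputable def Q (x : ℝ) : ℝ := (5 / (2 * Real.cosh (3 * x / 2) ^ 2)) ^ ((1:ℝ)/3)

/-- The linearized operator `L f = −f'' + f − 4Q³ f`. -/
noncomputable def LQ (f : ℝ → ℝ) : ℝ → ℝ :=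
  fun x => -iteratedDeriv 2 f x + f x - 4 * (Q x) ^ 3 * f x

open scoped Topology

/-- The rescaled hyperbolic tangent `x ↦ tanh (3x/2)`, equal to `-Q'/Q`. -/
noncomputable def solitonTanh (x : ℝ) : ℝ := Real.tanh (3 * x / 2)

theorem hasDerivAt_solitonTanh (x : ℝ) :
    HasDerivAt solitonTanh (3 / 2 * (1 - solitonTanh x ^ 2)) x := by
  have hc : Real.cosh (3 * x / 2) ≠ 0 := (Real.cosh_pos _).ne'
  have hlin : HasDerivAt (fun y : ℝ => 3 * y / 2) (3 / 2) x := by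
    simpa using ((hasDerivAt_id x).const_mul 3).div_const 2
  have h := hlin.sinh.fun_div hlin.cosh hc
  have heq : solitonTanh = fun y => Real.sinh (3 * y / 2) / Real.cosh (3 * y / 2) := by
    funext y
    exact Real.tanh_eq_sinh_div_cosh _
  rw [heq]
  refine h.congr_deriv ?_
  field_simp

theorem solitonTanh_sq_lt_one (x : ℝ) : solitonTanh x ^ 2 < 1 := Real.tanh_sq_lt_one _

theorem solitonTanh_zero : solitonTanh 0 = 0 := by simp [solitonTanh]

theorem solitonTanh_ne_zero {x : ℝ} (hx : x ≠ 0) : solitonTanh x ≠ 0 := by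
  rw [solitonTanh, Real.tanh_eq_sinh_div_cosh]
  refine div_ne_zero ?_ (Real.cosh_pos _).ne'
  rw [Ne, Real.sinh_eq_zero]
  simpa using hx

theorem Q_pos (x : ℝ) : 0 < Q x := by
  have := Real.cosh_pos (3 * x / 2)
  unfold Q
  positivity

theorem Q_pow_three_eq_cosh (x : ℝ) : Q x ^ 3 = 5 / (2 * Real.cosh (3 * x / 2) ^ 2) := by
  have := Real.cosh_pos (3 * x / 2)
  unfold Q
  rw [← Real.rpow_natCast, ← Real.rpow_mul (by positivity)]
  norm_num

theorem Q_pow_three (x : ℝ) : Q x ^ 3 = 5 / 2 * (1 - solitonTanh x ^ 2) := by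
  have hc : Real.cosh (3 * x / 2) ≠ 0 := (Real.cosh_pos _).ne'
  rw [Q_pow_three_eq_cosh, solitonTanh, Real.tanh_eq_sinh_div_cosh]
  field_simp
  rw [Real.cosh_sq]
  ring

theorem hasDerivAt_Q (x : ℝ) : HasDerivAt Q (-(solitonTanh x * Q x)) x := by
  have hT := solitonTanh_sq_lt_one x
  have hpos : 0 < 5 / 2 * (1 - solitonTanh x ^ 2) := by linarith
  have heq : Q = fun y => (5 / 2 * (1 - solitonTanh y ^ 2)) ^ ((1 : ℝ) / 3) := by
    funext y
    rw [← Q_pow_three, ← Real.rpow_natCast, ← Real.rpow_mul (Q_pos y).le]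
    norm_num
  have h := ((((hasDerivAt_solitonTanh x).fun_pow 2).const_sub 1).const_mul (5 / 2)).rpow_const
    (p := (1 : ℝ) / 3) (Or.inl hpos.ne')
  rw [heq]
  refine h.congr_deriv ?_
  rw [Real.rpow_sub_one hpos.ne']
  have : 1 - solitonTanh x ^ 2 ≠ 0 := by linarith
  field_simp
  ring

theorem Q_le_exp_neg_abs (x : ℝ) : Q x ≤ 3 * Real.exp (-|x|) := by
  have hcosh : Real.exp (3 * |x| / 2) / 2 ≤ Real.cosh (3 * x / 2) := by
    rw [← Real.cosh_abs, abs_div, abs_mul, abs_of_pos (by norm_num : (0 : ℝ) < 3),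
      abs_of_pos (by norm_num : (0 : ℝ) < 2), Real.cosh_eq]
    have := Real.exp_pos (-(3 * |x| / 2))
    linarith
  have hsq : (Real.exp (3 * |x| / 2) / 2) ^ 2 ≤ Real.cosh (3 * x / 2) ^ 2 :=
    pow_le_pow_left₀ (by positivity) hcosh 2
  have hexp : Real.exp (3 * |x| / 2) ^ 2 * Real.exp (-|x|) ^ 3 = 1 := by
    rw [← Real.exp_nat_mul, ← Real.exp_nat_mul, ← Real.exp_add, Real.exp_eq_one_iff]
    push_cast
    ring
  refine le_of_pow_le_pow_left₀ three_ne_zero (by positivity) ?_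
  rw [Q_pow_three_eq_cosh, div_le_iff₀ (by have := Real.cosh_pos (3 * x / 2); positivity)]
  have := mul_le_mul_of_nonneg_left hsq (by positivity : 0 ≤ Real.exp (-|x|) ^ 3)
  nlinarith

theorem tendsto_pow_abs_mul_Q (n : ℕ) :
    Tendsto (fun x => |x| ^ n * Q x) (cocompact ℝ) (𝓝 0) := by
  have h : Tendsto (fun x : ℝ => 3 * (|x| ^ n * Real.exp (-|x|))) (cocompact ℝ) (𝓝 0) := by
    simpa using ((Real.tendsto_pow_mul_exp_neg_atTop_nhds_zero n).comp
      (tendsto_norm_cocompact_atTop (E := ℝ))).const_mul 3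
  refine squeeze_zero (fun x => mul_nonneg (by positivity) (Q_pos x).le) (fun x => ?_) h
  have := mul_le_mul_of_nonneg_left (Q_le_exp_neg_abs x) (by positivity : 0 ≤ |x| ^ n)
  linarith

theorem tendsto_Q : Tendsto Q (cocompact ℝ) (𝓝 0) := by
  simpa using tendsto_pow_abs_mul_Q 0

theorem tendsto_id_mul_Q : Tendsto (fun x => x * Q x) (cocompact ℝ) (𝓝 0) := by
  refine (tendsto_zero_iff_abs_tendsto_zero _).2 ((tendsto_pow_abs_mul_Q 1).congr fun x => ?_)
  simp [abs_of_pos (Q_pos x)]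

theorem tendsto_solitonTanh_sq : Tendsto (fun x => solitonTanh x ^ 2) (cocompact ℝ) (𝓝 1) := by
  have h : Tendsto (fun x => 1 - 2 / 5 * Q x ^ 3) (cocompact ℝ) (𝓝 1) := by
    simpa using ((tendsto_Q.pow 3).const_mul (2 / 5)).const_sub 1
  refine h.congr fun x => ?_
  rw [Q_pow_three]
  ring

theorem Filter.Tendsto.solitonTanh_mul {f : ℝ → ℝ} {l : Filter ℝ} (hf : Tendsto f l (𝓝 0)) :
    Tendsto (fun x => solitonTanh x * f x) l (𝓝 0) := by
  refine squeeze_zero_norm (fun x => ?_) (tendsto_zero_iff_norm_tendsto_zero.1 hf)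
  rw [norm_mul]
  exact mul_le_of_le_one_left (norm_nonneg _) (Real.abs_tanh_lt_one _).le

/-- The generator of scaling applied to the ground state, `ΛQ = (2/3) Q + x Q'`;
it satisfies `L (ΛQ) = -2 Q`. -/
noncomputable def scalingQ (x : ℝ) : ℝ := 2 / 3 * Q x - solitonTanh x * (x * Q x)

/-- The derivative of `scalingQ`. -/
noncomputable def scalingQDeriv (x : ℝ) : ℝ :=
  -(5 / 3) * (solitonTanh x * Q x) + (5 / 2 * solitonTanh x ^ 2 - 3 / 2) * (x * Q x)

theorem hasDerivAt_scalingQ (x : ℝ) : HasDerivAt scalingQ (scalingQDeriv x) x := by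
  have h := ((hasDerivAt_Q x).const_mul (2 / 3)).fun_sub
    ((hasDerivAt_solitonTanh x).fun_mul ((hasDerivAt_id' x).fun_mul (hasDerivAt_Q x)))
  refine h.congr_deriv ?_
  unfold scalingQDeriv
  ring

theorem hasDerivAt_scalingQDeriv (x : ℝ) :
    HasDerivAt scalingQDeriv
      ((10 * solitonTanh x ^ 2 - 9) * scalingQ x + 2 * Q x) x := by
  have h := (((hasDerivAt_solitonTanh x).fun_mul (hasDerivAt_Q x)).const_mul (-(5 / 3))).fun_add
    (((((hasDerivAt_solitonTanh x).fun_pow 2).const_mul (5 / 2)).sub_const (3 / 2)).fun_mul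
      ((hasDerivAt_id' x).fun_mul (hasDerivAt_Q x)))
  refine h.congr_deriv ?_
  unfold scalingQ
  push_cast
  ring

theorem tendsto_scalingQ : Tendsto scalingQ (cocompact ℝ) (𝓝 0) := by
  have := (tendsto_Q.const_mul (2 / 3)).sub tendsto_id_mul_Q.solitonTanh_mul
  rwa [mul_zero, sub_zero] at this

theorem tendsto_scalingQDeriv : Tendsto scalingQDeriv (cocompact ℝ) (𝓝 0) := by
  have := (tendsto_Q.solitonTanh_mul.const_mul (-(5 / 3))).add
    (((tendsto_solitonTanh_sq.const_mul (5 / 2)).sub_const (3 / 2)).mul tendsto_id_mul_Q)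
  rwa [mul_zero, mul_zero, add_zero] at this

/-- The singular logarithmic derivative `Q'' / Q'`. -/
noncomputable def logDerivQ' (x : ℝ) : ℝ :=
  (3 / 2 - 5 / 2 * solitonTanh x ^ 2) / solitonTanh x

theorem hasDerivAt_logDerivQ' {x : ℝ} (hx : x ≠ 0) :
    HasDerivAt logDerivQ' (10 * solitonTanh x ^ 2 - 9 - logDerivQ' x ^ 2) x := by
  have hT := solitonTanh_ne_zero hx
  have h := ((((hasDerivAt_solitonTanh x).fun_pow 2).const_mul (5 / 2)).const_sub (3 / 2)).fun_div
    (hasDerivAt_solitonTanh x) hT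
  refine h.congr_deriv ?_
  unfold logDerivQ'
  field_simp
  ring

theorem tendsto_logDerivQ'_mul_sq {h : ℝ → ℝ} (hh : Tendsto h (cocompact ℝ) (𝓝 0)) :
    Tendsto (fun x => logDerivQ' x * h x ^ 2) (cocompact ℝ) (𝓝 0) := by
  have h2 : Tendsto (fun x => h x ^ 2) (cocompact ℝ) (𝓝 0) := by simpa using hh.pow 2
  have key : Tendsto (fun x => (3 / 2 - 5 / 2 * solitonTanh x ^ 2) * (solitonTanh x * h x ^ 2) /
      solitonTanh x ^ 2) (cocompact ℝ) (𝓝 0) := by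
    have := (((tendsto_solitonTanh_sq.const_mul (5 / 2)).const_sub (3 / 2)).mul
      h2.solitonTanh_mul).div tendsto_solitonTanh_sq one_ne_zero
    rwa [mul_zero, zero_div] at this
  refine key.congr fun x => ?_
  rcases eq_or_ne (solitonTanh x) 0 with hT | hT
  · simp [logDerivQ', hT]
  · unfold logDerivQ'
    field_simp

theorem continuousAt_logDerivQ'_mul_sq {h : ℝ → ℝ} {h' : ℝ} (hh : HasDerivAt h h' 0)
    (h0 : h 0 = 0) : ContinuousAt (fun x => logDerivQ' x * h x ^ 2) 0 := by
  rw [continuousAt_iff_punctured_nhds]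
  have hT := hasDerivAt_solitonTanh 0
  have hslope := (hh.tendsto_slope.div hT.tendsto_slope (by simp [solitonTanh_zero]))
  have hTc : Tendsto solitonTanh (𝓝[≠] 0) (𝓝 (solitonTanh 0)) :=
    hT.continuousAt.tendsto.mono_left nhdsWithin_le_nhds
  have hhc : Tendsto h (𝓝[≠] 0) (𝓝 (h 0)) :=
    hh.continuousAt.tendsto.mono_left nhdsWithin_le_nhds
  have key := (((hTc.pow 2).const_mul (5 / 2)).const_sub (3 / 2)).mul (hhc.mul hslope)
  rw [h0, zero_mul, mul_zero] at key
  simp only [h0, ne_eq, OfNat.ofNat_ne_zero, not_false_eq_true, zero_pow, mul_zero]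
  refine key.congr' ?_
  filter_upwards [self_mem_nhdsWithin] with x hx
  have hx' : x ≠ 0 := hx
  have := solitonTanh_ne_zero hx'
  simp only [Pi.div_apply, slope_def_field, h0, solitonTanh_zero, sub_zero, logDerivQ']
  field_simp

/-- A continuous function that vanishes at infinity and has nonnegative derivative away from the
origin has zero derivative there. -/
theorem deriv_eq_zero_of_nonneg_of_tendsto_cocompact {G D : ℝ → ℝ} (hcont : ContinuousAt G 0)
    (hderiv : ∀ x, x ≠ 0 → HasDerivAt G (D x) x) (hD : ∀ x, x ≠ 0 → 0 ≤ D x)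
    (hG : Tendsto G (cocompact ℝ) (𝓝 0)) {x : ℝ} (hx : x ≠ 0) : D x = 0 := by
  have hc : Continuous G := continuous_iff_continuousAt.2 fun y => by
    rcases eq_or_ne y 0 with rfl | hy
    · exact hcont
    · exact (hderiv y hy).continuousAt
  have hleft : MonotoneOn G (Set.Iic 0) := by
    refine monotoneOn_of_deriv_nonneg (convex_Iic 0) hc.continuousOn ?_ ?_ <;>
      rw [interior_Iic] <;> intro y hy
    · exact (hderiv y (ne_of_lt hy)).differentiableAt.differentiableWithinAt
    · rw [(hderiv y (ne_of_lt hy)).deriv]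
      exact hD y (ne_of_lt hy)
  have hright : MonotoneOn G (Set.Ici 0) := by
    refine monotoneOn_of_deriv_nonneg (convex_Ici 0) hc.continuousOn ?_ ?_ <;>
      rw [interior_Ici] <;> intro y hy
    · exact (hderiv y (ne_of_gt hy)).differentiableAt.differentiableWithinAt
    · rw [(hderiv y (ne_of_gt hy)).deriv]
      exact hD y (ne_of_gt hy)
  have hmono : Monotone G := hleft.Iic_union_Ici hright
  rw [cocompact_eq_atBot_atTop, tendsto_sup] at hG
  have hzero : G = fun _ => 0 := funext fun y =>
    le_antisymm (hmono.ge_of_tendsto hG.2 y) (hmono.le_of_tendsto hG.1 y)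
  have h := hderiv x hx
  rw [hzero] at h
  exact h.unique (hasDerivAt_const x 0)

/-- A function that is square integrable together with its derivative vanishes at infinity. -/
theorem tendsto_cocompact_of_integrable_sq {f f' : ℝ → ℝ} (hderiv : ∀ x, HasDerivAt f (f' x) x)
    (hf : Integrable fun x => f x ^ 2) (hf' : Integrable fun x => f' x ^ 2) :
    Tendsto f (cocompact ℝ) (𝓝 0) := by
  have hfm : AEStronglyMeasurable f :=
    (continuous_iff_continuousAt.2 fun x => (hderiv x).continuousAt).aestronglyMeasurable
  have hfm' : AEStronglyMeasurable f' := by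
    have : f' = deriv f := funext fun x => (hderiv x).deriv.symm
    rw [this]
    exact aestronglyMeasurable_deriv f _
  have hint : Integrable fun x => 2 * (f x * f' x) :=
    (((memLp_two_iff_integrable_sq hfm).2 hf).integrable_mul
      ((memLp_two_iff_integrable_sq hfm').2 hf')).const_mul 2
  have hsq : ∀ x, HasDerivAt (fun y => f y ^ 2) (2 * (f x * f' x)) x := fun x =>
    ((hderiv x).fun_pow 2).congr_deriv (by push_cast; ring)
  have hlim : Tendsto (fun x => f x ^ 2) (cocompact ℝ) (𝓝 0) := by
    rw [cocompact_eq_atBot_atTop, tendsto_sup]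
    exact ⟨tendsto_zero_of_hasDerivAt_of_integrableOn_Iic (a := 0) (fun x _ => hsq x)
        hint.integrableOn hf.integrableOn,
      tendsto_zero_of_hasDerivAt_of_integrableOn_Ioi (a := 0) (fun x _ => hsq x)
        hint.integrableOn hf.integrableOn⟩
  have habs := (Real.continuous_sqrt.tendsto 0).comp hlim
  rw [Real.sqrt_zero] at habs
  refine (tendsto_zero_iff_abs_tendsto_zero _).2 (habs.congr fun x => ?_)
  simp [Real.sqrt_sq_eq_abs]

/-- With `B = L A` and `B' = -θ A`, decay of `A, A', A''` at infinity forces `A = 0`. -/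
theorem eq_zero_of_hasDerivAt_of_tendsto {θ : ℝ} (hθ : θ ≠ 0) {A A' A'' B : ℝ → ℝ}
    (hA : ∀ x, HasDerivAt A (A' x) x) (hA' : ∀ x, HasDerivAt A' (A'' x) x)
    (hB : ∀ x, HasDerivAt B (-(θ * A x)) x)
    (hBA : ∀ x, B x = -A'' x + A x - 10 * (1 - solitonTanh x ^ 2) * A x)
    (limA : Tendsto A (cocompact ℝ) (𝓝 0)) (limA' : Tendsto A' (cocompact ℝ) (𝓝 0))
    (limA'' : Tendsto A'' (cocompact ℝ) (𝓝 0)) (x : ℝ) : A x = 0 := by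
  obtain ⟨t, ht⟩ : ∃ t, A 0 - t * scalingQ 0 = 0 := by
    refine ⟨A 0 / scalingQ 0, ?_⟩
    have : scalingQ 0 ≠ 0 := by
      simpa [scalingQ, solitonTanh_zero] using (Q_pos 0).ne'
    field_simp
    ring
  set h : ℝ → ℝ := fun x => A x - t * scalingQ x with hh
  set h' : ℝ → ℝ := fun x => A' x - t * scalingQDeriv x with hh'
  have hder : ∀ x, HasDerivAt h (h' x) x := fun x =>
    (hA x).fun_sub ((hasDerivAt_scalingQ x).const_mul t)
  have limh : Tendsto h (cocompact ℝ) (𝓝 0) := by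
    simpa [hh] using limA.sub (tendsto_scalingQ.const_mul t)
  -- `P` is a primitive of `-θ A Q`
  set P : ℝ → ℝ := fun x => B x * Q x - A' x * (solitonTanh x * Q x) -
    A x * ((5 / 2 * solitonTanh x ^ 2 - 3 / 2) * Q x) with hP
  have derP : ∀ x, HasDerivAt P (-(θ * A x * Q x)) x := fun x => by
    have hT := hasDerivAt_solitonTanh x
    have hQ := hasDerivAt_Q x
    have := (((hB x).fun_mul hQ).fun_sub ((hA' x).fun_mul (hT.fun_mul hQ))).fun_sub
      ((hA x).fun_mul ((((hT.fun_pow 2).const_mul (5 / 2)).sub_const (3 / 2)).fun_mul hQ))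
    refine this.congr_deriv ?_
    rw [hBA x]
    push_cast
    ring
  set R : ℝ → ℝ := fun x => A x * A' x - B x ^ 2 / (2 * θ) -
    2 * t * (2 / θ * P x + A x * scalingQDeriv x) +
    t ^ 2 * (scalingQ x * scalingQDeriv x - x * Q x * Q x) with hR
  have derR : ∀ x, HasDerivAt R
      (h' x ^ 2 + (10 * solitonTanh x ^ 2 - 9) * h x ^ 2 + t ^ 2 * Q x ^ 2 / 3) x := fun x => by
    have hg := hasDerivAt_scalingQ x
    have hg' := hasDerivAt_scalingQDeriv x
    have hQ := hasDerivAt_Q x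
    have := ((((hA x).fun_mul (hA' x)).fun_sub (((hB x).fun_pow 2).div_const (2 * θ))).fun_sub
      ((((derP x).const_mul (2 / θ)).fun_add ((hA x).fun_mul hg')).const_mul (2 * t))).fun_add
      (((hg.fun_mul hg').fun_sub (((hasDerivAt_id' x).fun_mul hQ).fun_mul hQ)).const_mul (t ^ 2))
    refine this.congr_deriv ?_
    simp only [hh, hh', hBA x, scalingQ]
    push_cast
    field_simp
    ring
  have limB : Tendsto B (cocompact ℝ) (𝓝 0) := by
    have := (limA''.neg.add limA).sub
      (((tendsto_solitonTanh_sq.const_sub 1).const_mul 10).mul limA)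
    simp only [neg_zero, add_zero, mul_zero, sub_zero] at this
    exact this.congr fun x => (hBA x).symm
  have limP : Tendsto P (cocompact ℝ) (𝓝 0) := by
    simpa [hP] using ((limB.mul tendsto_Q).sub (limA'.mul tendsto_Q.solitonTanh_mul)).sub
      (limA.mul (((tendsto_solitonTanh_sq.const_mul (5 / 2)).sub_const (3 / 2)).mul tendsto_Q))
  have limR : Tendsto R (cocompact ℝ) (𝓝 0) := by
    simpa [hR] using (((limA.mul limA').sub ((limB.pow 2).div_const (2 * θ))).sub
      (((limP.const_mul (2 / θ)).add (limA.mul tendsto_scalingQDeriv)).const_mul (2 * t))).add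
      (((tendsto_scalingQ.mul tendsto_scalingQDeriv).sub
        (tendsto_id_mul_Q.mul tendsto_Q)).const_mul (t ^ 2))
  have hvanish : ∀ x, x ≠ 0 →
      (h' x - logDerivQ' x * h x) ^ 2 + t ^ 2 * Q x ^ 2 / 3 = 0 := fun x hx => by
    refine deriv_eq_zero_of_nonneg_of_tendsto_cocompact
      (G := fun x => R x - logDerivQ' x * h x ^ 2)
      (D := fun x => (h' x - logDerivQ' x * h x) ^ 2 + t ^ 2 * Q x ^ 2 / 3)
      ((derR 0).continuousAt.sub (continuousAt_logDerivQ'_mul_sq (hder 0) ht))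
      (fun y hy => ?_) (fun y _ => by positivity) ?_ hx
    · refine ((derR y).fun_sub ((hasDerivAt_logDerivQ' hy).fun_mul
        ((hder y).fun_pow 2))).congr_deriv ?_
      push_cast
      ring
    · simpa using limR.sub (tendsto_logDerivQ'_mul_sq limh)
  have ht0 : t = 0 := by
    have h1 := hvanish 1 one_ne_zero
    have hQ := Q_pos 1
    by_contra hne
    have : 0 < t ^ 2 * Q 1 ^ 2 / 3 := by positivity
    nlinarith [sq_nonneg (h' 1 - logDerivQ' 1 * h 1)]
  have hA0 : A 0 = 0 := by simpa [ht0] using ht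
  have hode : ∀ x, solitonTanh x * A' x = (3 / 2 - 5 / 2 * solitonTanh x ^ 2) * A x := fun x => by
    rcases eq_or_ne x 0 with rfl | hx
    · simp [hA0, solitonTanh_zero]
    have h1 := hvanish x hx
    have hT := solitonTanh_ne_zero hx
    simp only [hh, hh', ht0, zero_mul, sub_zero, ne_eq, OfNat.ofNat_ne_zero, not_false_eq_true,
      zero_pow, zero_div, add_zero, pow_eq_zero_iff, sub_eq_zero] at h1
    rw [h1, logDerivQ']
    field_simp
  have hTB : ∀ x, solitonTanh x * B x = 0 := fun x => by
    rcases eq_or_ne x 0 with rfl | hx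
    · simp [solitonTanh_zero]
    have hT := hasDerivAt_solitonTanh x
    have hl := hT.fun_mul (hA' x)
    have hr := (((hT.fun_pow 2).const_mul (5 / 2)).const_sub (3 / 2)).fun_mul (hA x)
    rw [funext hode] at hl
    have h1 := hl.unique hr
    push_cast at h1
    rw [hBA x]
    have h2 := hode x
    have hTx := solitonTanh_ne_zero hx
    refine (mul_eq_zero.1 (?_ : solitonTanh x * _ = 0)).resolve_left hTx
    linear_combination (-solitonTanh x) * h1 + solitonTanh x ^ 2 * h2
  rcases eq_or_ne x 0 with rfl | hx
  · exact hA0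
  have hBx : B x = 0 := (mul_eq_zero.1 (hTB x)).resolve_left (solitonTanh_ne_zero hx)
  have hd := (hasDerivAt_solitonTanh x).fun_mul (hB x)
  rw [funext hTB] at hd
  have := hd.unique (hasDerivAt_const x 0)
  simpa [hBx, hθ, solitonTanh_ne_zero hx] using this

theorem natCast_le_smooth (k : ℕ) : (k : WithTop ℕ∞) ≤ ((⊤ : ℕ∞) : WithTop ℕ∞) := by
  exact_mod_cast le_top

theorem ContDiff.hasDerivAt_iteratedDeriv {A : ℝ → ℝ} (hA : ContDiff ℝ (⊤ : ℕ∞) A) (k : ℕ)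
    (x : ℝ) : HasDerivAt (iteratedDeriv k A) (iteratedDeriv (k + 1) A x) x := by
  rw [iteratedDeriv_succ]
  exact (hA.differentiable_iteratedDeriv k
    (by exact_mod_cast ENat.natCast_lt_top k) x).hasDerivAt

theorem iteratedDeriv_sub_of_smooth {A₁ A₂ : ℝ → ℝ} (h₁ : ContDiff ℝ (⊤ : ℕ∞) A₁)
    (h₂ : ContDiff ℝ (⊤ : ℕ∞) A₂) (k : ℕ) :
    iteratedDeriv k (A₁ - A₂) = fun x => iteratedDeriv k A₁ x - iteratedDeriv k A₂ x :=
  funext fun _ => iteratedDeriv_sub (h₁.of_le (natCast_le_smooth k)).contDiffAt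
    (h₂.of_le (natCast_le_smooth k)).contDiffAt

theorem differentiable_LQ {A : ℝ → ℝ} (hA : ContDiff ℝ (⊤ : ℕ∞) A) : Differentiable ℝ (LQ A) := by
  have h2 : Differentiable ℝ (iteratedDeriv 2 A) :=
    fun x => (hA.hasDerivAt_iteratedDeriv 2 x).differentiableAt
  have h0 : Differentiable ℝ A := hA.differentiable (by simp)
  have hQ : Differentiable ℝ Q := fun x => (hasDerivAt_Q x).differentiableAt
  unfold LQ
  fun_prop

theorem eq_zero_of_deriv_LQ_add_eq_zero {θ : ℝ} (hθ : θ ≠ 0) {A : ℝ → ℝ}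
    (hA : ContDiff ℝ (⊤ : ℕ∞) A)
    (hint : ∀ k : ℕ, k ≤ 3 → Integrable (fun x => (iteratedDeriv k A x) ^ 2))
    (heq : ∀ x : ℝ, deriv (LQ A) x + θ * A x = 0) (x : ℝ) : A x = 0 := by
  have hder := hA.hasDerivAt_iteratedDeriv
  have hlim : ∀ k, k ≤ 2 → Tendsto (iteratedDeriv k A) (cocompact ℝ) (𝓝 0) := fun k hk =>
    tendsto_cocompact_of_integrable_sq (hder k) (hint k (by lia)) (hint (k + 1) (by lia))
  have hB : ∀ x, HasDerivAt (LQ A) (-(θ * A x)) x := fun x => by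
    rw [← eq_neg_of_add_eq_zero_left (heq x)]
    exact (differentiable_LQ hA x).hasDerivAt
  have hder0 := hder 0
  have hlim0 := hlim 0 (by lia)
  rw [iteratedDeriv_zero] at hder0 hlim0
  refine eq_zero_of_hasDerivAt_of_tendsto hθ hder0 (hder 1) hB (fun x => ?_) hlim0
    (hlim 1 (by lia)) (hlim 2 le_rfl) x
  rw [LQ, Q_pow_three]
  ring

theorem LQ_sub {A₁ A₂ : ℝ → ℝ} (h₁ : ContDiff ℝ (⊤ : ℕ∞) A₁) (h₂ : ContDiff ℝ (⊤ : ℕ∞) A₂) :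
    LQ (A₁ - A₂) = LQ A₁ - LQ A₂ := by
  funext x
  simp only [LQ, Pi.sub_apply, iteratedDeriv_sub_of_smooth h₁ h₂]
  ring

theorem integrable_sq_sub_of_continuous {f g : ℝ → ℝ} (hf : Continuous f) (hg : Continuous g)
    (hf2 : Integrable fun x => f x ^ 2) (hg2 : Integrable fun x => g x ^ 2) :
    Integrable fun x => (f x - g x) ^ 2 :=
  (memLp_two_iff_integrable_sq (hf.sub hg).aestronglyMeasurable).1
    (((memLp_two_iff_integrable_sq hf.aestronglyMeasurable).2 hf2).sub
      ((memLp_two_iff_integrable_sq hg.aestronglyMeasurable).2 hg2))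

/-- The operator `f ↦ (Lf)'` has no nonzero real eigenvalue
(Pego–Weinstein), and consequently the equation `(LA)' + θA = F` has at most one
solution with `A, A', A'', A''' ∈ L²` for `θ > 0`. -/
theorem no_real_eigenvalue :
    (∀ θ : ℝ, θ ≠ 0 → ∀ A : ℝ → ℝ, ContDiff ℝ (⊤ : ℕ∞) A →
      (∀ k : ℕ, k ≤ 3 → Integrable (fun x => (iteratedDeriv k A x) ^ 2)) →
      (∀ x : ℝ, deriv (LQ A) x + θ * A x = 0) →
      ∀ x : ℝ, A x = 0) ∧
    (∀ θ : ℝ, 0 < θ → ∀ F : ℝ → ℝ, Integrable (fun x => (F x) ^ 2) →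
      ∀ A₁ A₂ : ℝ → ℝ, ContDiff ℝ (⊤ : ℕ∞) A₁ → ContDiff ℝ (⊤ : ℕ∞) A₂ →
      (∀ k : ℕ, k ≤ 3 → Integrable (fun x => (iteratedDeriv k A₁ x) ^ 2)) →
      (∀ k : ℕ, k ≤ 3 → Integrable (fun x => (iteratedDeriv k A₂ x) ^ 2)) →
      (∀ x : ℝ, deriv (LQ A₁) x + θ * A₁ x = F x) →
      (∀ x : ℝ, deriv (LQ A₂) x + θ * A₂ x = F x) →
      A₁ = A₂) := by
  refine ⟨fun θ hθ A hA hint heq => eq_zero_of_deriv_LQ_add_eq_zero hθ hA hint heq,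
    fun θ hθ F _ A₁ A₂ h₁ h₂ hint₁ hint₂ heq₁ heq₂ => ?_⟩
  rw [← sub_eq_zero]
  funext x
  refine eq_zero_of_deriv_LQ_add_eq_zero (A := A₁ - A₂) hθ.ne' (h₁.sub h₂) (fun k hk => ?_) (fun x => ?_) x
  · rw [iteratedDeriv_sub_of_smooth h₁ h₂]
    exact integrable_sq_sub_of_continuous (h₁.continuous_iteratedDeriv k (natCast_le_smooth k))
      (h₂.continuous_iteratedDeriv k (natCast_le_smooth k)) (hint₁ k hk) (hint₂ k hk)
  · change deriv (LQ (A₁ - A₂)) x + θ * (A₁ x - A₂ x) = 0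
    rw [LQ_sub h₁ h₂, deriv_sub (differentiable_LQ h₁ x) (differentiable_LQ h₂ x)]
    linear_combination heq₁ x - heq₂ x
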